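/- Let T > 0, let I and J be absolutely continuous nonnegative real-valued functions on [0,T] with J ∈ L²(0,T), and let a, c ∈ L¹(0,T) and b ∈ L²(0,T) be nonnegative functions. If I′(t) + J(t)² ≤ a(t)·I(t) + b(t)·J(t) + c(t) for a.e. t ∈ [0,T], then ∫₀ᵀ J(t)² dt ≤ C_a · ( ‖b‖_{L²(0,T)}·‖J‖_{L²(0,T)} + ‖c‖_{L¹(0,T)} + I(0) ), where C_a = 1 + A·e^A and A = ‖a‖_{L¹(0,T)}. -/

import Mathlib

open MeasureTheory

/-- `f` is absolutely continuous on `[0,T]` with (a.e.) derivative `f'`: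
`f'` is Lebesgue integrable on `(0,T)` and `f t = f 0 + ∫₀ᵗ f' s ds` on `[0,T]`. -/
def IsACOn (f f' : ℝ → ℝ) (T : ℝ) : Prop :=
  IntegrableOn f' (Set.Ioc 0 T) ∧ ∀ t ∈ Set.Icc 0 T, f t = f 0 + ∫ s in (0:ℝ)..t, f' s

/-- `‖f‖_{L¹(0,t)} = ∫₀ᵗ |f s| ds`. -/
noncomputable def L1N (f : ℝ → ℝ) (t : ℝ) : ℝ := ∫ s in (0:ℝ)..t, |f s|

/-- `‖f‖_{L²(0,t)} = (∫₀ᵗ f s ^ 2 ds)^{1/2}`. -/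
noncomputable def L2N (f : ℝ → ℝ) (t : ℝ) : ℝ := Real.sqrt (∫ s in (0:ℝ)..t, (f s)^2)

/-- `‖f‖_{L^∞(0,T)}`: the essential supremum of `|f|` on `(0,T)`. -/
noncomputable def LInfN (f : ℝ → ℝ) (T : ℝ) : ℝ :=
  essSup (fun t => |f t|) (MeasureTheory.volume.restrict (Set.Ioo 0 T))

open Set

/-- Postcomposition with a Lipschitz function preserves absolute continuity. -/
theorem LipschitzOnWith.comp_absolutelyContinuousOnInterval {X Y : Type*} [PseudoMetricSpace X]
    [PseudoMetricSpace Y] {φ : X → Y} {s : Set X} {K : NNReal} {f : ℝ → X} {a b : ℝ}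
    (hφ : LipschitzOnWith K φ s) (hf : AbsolutelyContinuousOnInterval f a b)
    (hfs : MapsTo f (uIcc a b) s) :
    AbsolutelyContinuousOnInterval (fun x => φ (f x)) a b := by
  rw [absolutelyContinuousOnInterval_iff] at hf ⊢
  intro ε hε
  obtain ⟨δ, hδ, h⟩ := hf (ε / (K + 1)) (by positivity)
  refine ⟨δ, hδ, fun E hE hlt => ?_⟩
  have hsum := h E hE hlt
  rw [lt_div_iff₀ (by positivity)] at hsum
  refine lt_of_le_of_lt ?_ hsum
  rw [Finset.sum_mul]
  refine Finset.sum_le_sum fun i hi => ?_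
  have hmem := hE.1 i hi
  refine (hφ.dist_le_mul _ (hfs hmem.1) _ (hfs hmem.2)).trans ?_
  rw [mul_comm]
  gcongr
  linarith

theorem lipschitzOnWith_exp_Iic_zero : LipschitzOnWith 1 Real.exp (Iic 0) := by
  refine (convex_Iic (0 : ℝ)).lipschitzOnWith_of_nnnorm_deriv_le
    (fun x _ => Real.differentiableAt_exp) fun x hx => ?_
  rw [← NNReal.coe_le_coe]
  simpa using hx

/-- Grönwall's inequality in integral form, with an integrable coefficient. -/
theorem add_integral_le_mul_exp_integral {T K : ℝ} (hT : 0 ≤ T) {a u : ℝ → ℝ}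
    (ha : IntervalIntegrable a volume 0 T) (ha0 : ∀ᵐ t ∂volume.restrict (Ioc 0 T), 0 ≤ a t)
    (hu : ContinuousOn u (Icc 0 T))
    (h : ∀ t ∈ Icc 0 T, u t ≤ K + ∫ s in (0 : ℝ)..t, a s * u s) :
    K + ∫ s in (0 : ℝ)..T, a s * u s ≤ K * Real.exp (∫ s in (0 : ℝ)..T, a s) := by
  have hau : IntervalIntegrable (fun s => a s * u s) volume 0 T :=
    ha.mul_continuousOn (by rwa [uIcc_of_le hT])
  set A : ℝ → ℝ := fun t => ∫ s in (0 : ℝ)..t, a s with hA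
  set F : ℝ → ℝ := fun t => ∫ s in (0 : ℝ)..t, a s * u s with hF
  have hA0 : ∀ t ∈ Icc 0 T, 0 ≤ A t := fun t ht => by
    simp only [hA, intervalIntegral.integral_of_le ht.1]
    exact setIntegral_nonneg_of_ae_restrict
      (ae_restrict_of_ae_restrict_of_subset (Ioc_subset_Ioc_right ht.2) ha0)
  have hFac : AbsolutelyContinuousOnInterval (fun t => K + F t) 0 T :=
    ((LipschitzWith.const K).lipschitzOnWith (s := uIcc 0 T)
      |>.absolutelyContinuousOnInterval).fun_add
      (hau.absolutelyContinuousOnInterval_intervalIntegral left_mem_uIcc)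
  have hEac : AbsolutelyContinuousOnInterval (fun t => Real.exp (-A t)) 0 T :=
    lipschitzOnWith_exp_Iic_zero.comp_absolutelyContinuousOnInterval
      (ha.absolutelyContinuousOnInterval_intervalIntegral left_mem_uIcc).fun_neg
      fun t ht => by
        rw [uIcc_of_le hT] at ht
        simpa using hA0 t ht
  have hparts := hFac.integral_deriv_mul_eq_sub hEac
  have hnonpos : ∫ x in (0 : ℝ)..T, deriv (fun t => K + F t) x * Real.exp (-A x) +
      (K + F x) * deriv (fun t => Real.exp (-A t)) x ≤ 0 := by
    rw [intervalIntegral.integral_of_le hT]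
    refine integral_nonpos_of_ae ?_
    filter_upwards [ha0, ae_restrict_mem measurableSet_Ioc,
      ae_restrict_of_ae ha.ae_hasDerivAt_integral,
      ae_restrict_of_ae hau.ae_hasDerivAt_integral] with t hat ht hAt hFt
    have htI : t ∈ uIcc 0 T := by rw [uIcc_of_le hT]; exact Ioc_subset_Icc_self ht
    have hA' : HasDerivAt A (a t) t := hAt htI 0 left_mem_uIcc
    have hF' : HasDerivAt F (a t * u t) t := hFt htI 0 left_mem_uIcc
    rw [(hF'.const_add K).deriv, hA'.fun_neg.exp.deriv]
    have hprod : 0 ≤ (a t * Real.exp (-A t)) * (K + F t - u t) :=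
      mul_nonneg (mul_nonneg hat (Real.exp_pos _).le)
        (sub_nonneg.2 (h t (Ioc_subset_Icc_self ht)))
    simp only [Pi.zero_apply]
    linarith
  have hF0 : F 0 = 0 := by simp [hF]
  have hA00 : A 0 = 0 := by simp [hA]
  rw [hparts, hF0, hA00] at hnonpos
  simp only [add_zero, neg_zero, Real.exp_zero, mul_one, sub_nonpos, Real.exp_neg,
    ← div_eq_mul_inv] at hnonpos
  exact (div_le_iff₀ (Real.exp_pos _)).1 hnonpos

/-- The Cauchy–Schwarz inequality for integrals of nonnegative real functions. -/
theorem integral_mul_le_sqrt_mul_sqrt {α : Type*} [MeasurableSpace α] {μ : Measure α}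
    {f g : α → ℝ} (hf0 : 0 ≤ᵐ[μ] f) (hg0 : 0 ≤ᵐ[μ] g) (hf : MemLp f 2 μ) (hg : MemLp g 2 μ) :
    ∫ x, f x * g x ∂μ ≤ √(∫ x, f x ^ 2 ∂μ) * √(∫ x, g x ^ 2 ∂μ) := by
  have h := integral_mul_le_Lp_mul_Lq_of_nonneg Real.HolderConjugate.two_two hf0 hg0
    (by simpa using hf) (by simpa using hg)
  simpa [Real.sqrt_eq_rpow] using h

/-- A function that is a.e. nonnegative and has integrable square is in `L²`. -/
theorem memLp_two_of_integrable_sq_of_nonneg {α : Type*} [MeasurableSpace α] {μ : Measure α}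
    {f : α → ℝ} (hf0 : 0 ≤ᵐ[μ] f) (hf : Integrable (fun x => f x ^ 2) μ) : MemLp f 2 μ := by
  refine (memLp_two_iff_integrable_sq ?_).2 hf
  refine (Real.continuous_sqrt.comp_aestronglyMeasurable hf.1).congr ?_
  filter_upwards [hf0] with x hx
  exact Real.sqrt_sq hx

theorem IsACOn.continuousOn {f f' : ℝ → ℝ} {T : ℝ} (hT : 0 ≤ T) (hf : IsACOn f f' T) :
    ContinuousOn f (Icc 0 T) := by
  have hint : IntervalIntegrable f' volume 0 T :=
    (intervalIntegrable_iff_integrableOn_Ioc_of_le hT).2 hf.1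
  have hac := hint.absolutelyContinuousOnInterval_intervalIntegral left_mem_uIcc
  have hc := hac.continuousOn
  rw [uIcc_of_le hT] at hc
  exact (continuousOn_const.add hc).congr hf.2

theorem Real.exp_le_one_add_mul_exp (x : ℝ) : Real.exp x ≤ 1 + x * Real.exp x := by
  have h := mul_le_mul_of_nonneg_right (Real.add_one_le_exp (-x)) (Real.exp_pos x).le
  rw [← Real.exp_add, neg_add_cancel, Real.exp_zero] at h
  linarith


theorem mixed_gronwall_J2_integral_bound
    (T : ℝ) (hT : 0 < T) (I I' J J' a b c : ℝ → ℝ)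
    (hI : IsACOn I I' T) (hJ : IsACOn J J' T)
    (hInn : ∀ t ∈ Set.Icc 0 T, 0 ≤ I t)
    (hJnn : ∀ t ∈ Set.Icc 0 T, 0 ≤ J t)
    (hJL2 : IntegrableOn (fun t => (J t)^2) (Set.Ioc 0 T))
    (haint : IntegrableOn a (Set.Ioc 0 T))
    (hcint : IntegrableOn c (Set.Ioc 0 T))
    (hbint : IntegrableOn (fun t => (b t)^2) (Set.Ioc 0 T))
    (hann : ∀ᵐ t ∂(volume.restrict (Set.Ioo 0 T)), 0 ≤ a t)
    (hbnn : ∀ᵐ t ∂(volume.restrict (Set.Ioo 0 T)), 0 ≤ b t)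
    (hcnn : ∀ᵐ t ∂(volume.restrict (Set.Ioo 0 T)), 0 ≤ c t)
    (hineq : ∀ᵐ t ∂(volume.restrict (Set.Ioo 0 T)),
      I' t + (J t)^2 ≤ a t * I t + b t * J t + c t)
    :
    ∫ t in (0:ℝ)..T, (J t)^2 ≤ (1 + L1N a T * Real.exp (L1N a T)) *
      (L2N b T * L2N J T + L1N c T + I 0) := by
  rw [restrict_Ioo_eq_restrict_Ioc] at hann hbnn hcnn hineq
  have hJ0 : 0 ≤ᵐ[volume.restrict (Ioc 0 T)] J := by
    filter_upwards [ae_restrict_mem measurableSet_Ioc] with t ht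
    exact hJnn t (Ioc_subset_Icc_self ht)
  have hJmem := memLp_two_of_integrable_sq_of_nonneg hJ0 hJL2
  have hbmem := memLp_two_of_integrable_sq_of_nonneg hbnn hbint
  have hIc := hI.continuousOn hT.le
  have ha : IntervalIntegrable a volume 0 T :=
    (intervalIntegrable_iff_integrableOn_Ioc_of_le hT.le).2 haint
  have haI : IntegrableOn (fun t => a t * I t) (Ioc 0 T) :=
    (ha.mul_continuousOn (by rwa [uIcc_of_le hT.le])).1
  have hbJ : IntegrableOn (fun t => b t * J t) (Ioc 0 T) := hbmem.integrable_mul hJmem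
  have haIbJ : IntegrableOn (fun t => a t * I t + b t * J t) (Ioc 0 T) := haI.add hbJ
  have hL1a : L1N a T = ∫ t in (0 : ℝ)..T, a t := by
    simp only [L1N, intervalIntegral.integral_of_le hT.le]
    exact integral_congr_ae (hann.mono fun t ht => abs_of_nonneg ht)
  have hL1c : L1N c T = ∫ t in Ioc 0 T, c t := by
    simp only [L1N, intervalIntegral.integral_of_le hT.le]
    exact integral_congr_ae (hcnn.mono fun t ht => abs_of_nonneg ht)
  have hCS : ∫ t in Ioc 0 T, b t * J t ≤ L2N b T * L2N J T := by
    simp only [L2N, intervalIntegral.integral_of_le hT.le]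
    exact integral_mul_le_sqrt_mul_sqrt hbnn hJ0 hbmem hJmem
  have hc0 : 0 ≤ L1N c T := hL1c ▸ integral_nonneg_of_ae hcnn
  have hK : 0 ≤ L2N b T * L2N J T + L1N c T + I 0 :=
    add_nonneg (add_nonneg (mul_nonneg (Real.sqrt_nonneg _) (Real.sqrt_nonneg _)) hc0)
      (hInn 0 (left_mem_Icc.2 hT.le))
  have henergy : ∀ t ∈ Icc 0 T, I t + ∫ s in (0 : ℝ)..t, J s ^ 2 ≤
      L2N b T * L2N J T + L1N c T + I 0 + ∫ s in (0 : ℝ)..t, a s * I s := fun t ht => by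
    have hsub : Ioc 0 t ⊆ Ioc 0 T := Ioc_subset_Ioc_right ht.2
    have hmono : ∫ s in Ioc 0 t, (I' s + J s ^ 2) ≤
        ∫ s in Ioc 0 t, (a s * I s + b s * J s + c s) :=
      setIntegral_mono_ae_restrict ((hI.1.add hJL2).mono_set hsub)
        ((haIbJ.add hcint).mono_set hsub)
        (ae_restrict_of_ae_restrict_of_subset hsub hineq)
    rw [integral_add (hI.1.mono_set hsub) (hJL2.mono_set hsub),
      integral_add (haIbJ.mono_set hsub) (hcint.mono_set hsub),
      integral_add (haI.mono_set hsub) (hbJ.mono_set hsub)] at hmono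
    have hbJle : ∫ s in Ioc 0 t, b s * J s ≤ ∫ s in Ioc 0 T, b s * J s := by
      refine setIntegral_mono_set hbJ ?_ hsub.eventuallyLE
      filter_upwards [hbnn, hJ0] with s hb hJ using mul_nonneg hb hJ
    have hcle : ∫ s in Ioc 0 t, c s ≤ ∫ s in Ioc 0 T, c s :=
      setIntegral_mono_set hcint hcnn hsub.eventuallyLE
    rw [hI.2 t ht]
    simp only [intervalIntegral.integral_of_le ht.1]
    linarith
  have hgronwall := add_integral_le_mul_exp_integral
      (K := L2N b T * L2N J T + L1N c T + I 0) hT.le ha hann hIc fun t ht => by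
    have hJ2 : 0 ≤ ∫ s in (0 : ℝ)..t, J s ^ 2 :=
      intervalIntegral.integral_nonneg ht.1 fun s _ => sq_nonneg (J s)
    linarith [henergy t ht]
  rw [← hL1a] at hgronwall
  have hTmem : T ∈ Icc 0 T := right_mem_Icc.2 hT.le
  calc ∫ t in (0 : ℝ)..T, J t ^ 2
      ≤ (L2N b T * L2N J T + L1N c T + I 0) * Real.exp (L1N a T) := by
        linarith [henergy T hTmem, hInn T hTmem]
    _ ≤ (1 + L1N a T * Real.exp (L1N a T)) * (L2N b T * L2N J T + L1N c T + I 0) := by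
        rw [mul_comm]
        exact mul_le_mul_of_nonneg_right (Real.exp_le_one_add_mul_exp _) hK
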